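/- There exists a computably enumerable set B ⊆ ℕ that is not semilow_{1.5}, such that for every splitting of B — i.e., every pair of disjoint computably enumerable sets X, Y with X ∪ Y = B — at least one of X and Y is semilow_{1.5}. -/

import Mathlib

open Nat.Partrec (Code)

/-- `Wset e` is the `e`-th computably enumerable set: the domain of the `e`-th
partial computable function in the standard enumeration. -/
def Wset (e : ℕ) : Set ℕ := {x | ((Denumerable.ofNat Code e).eval x).Dom}

/-- A set is computably enumerable iff it occurs in the standard enumeration. -/
def CEset (A : Set ℕ) : Prop := ∃ e, Wset e = A

/-- `A` is semilow_{1.5} if `{e : W e ∩ Aᶜ infinite}` is one-one reducible to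
`Inf = {e : W e infinite}`. -/
def Semilow15 (A : Set ℕ) : Prop :=
  OneOneReducible (fun e => (Wset e ∩ Aᶜ).Infinite) (fun e => (Wset e).Infinite)

namespace MaxSet

/-! ### Stage approximations and basic facts on c.e. sets -/

/-- `x ∈ W_{e,s}`. -/
def wn (e s x : ℕ) : Bool := (Code.evaln s (Denumerable.ofNat Code e) x).isSome

theorem wn_primrec : Primrec fun p : (ℕ × ℕ) × ℕ => wn p.1.1 p.1.2 p.2 := by
  unfold wn
  refine Primrec.option_isSome.comp (Code.primrec_evaln.comp
    (Primrec.pair (Primrec.pair (Primrec.snd.comp Primrec.fst) ?_) Primrec.snd))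
  exact (Primrec.ofNat Code).comp (Primrec.fst.comp Primrec.fst)

theorem wn_comp {α : Type*} [Primcodable α] {f g h : α → ℕ} (hf : Primrec f) (hg : Primrec g)
    (hh : Primrec h) : Primrec fun a => wn (f a) (g a) (h a) :=
  wn_primrec.comp ((hf.pair hg).pair hh)

theorem wn_mono {e s t x : ℕ} (h : s ≤ t) (hs : wn e s x = true) : wn e t x = true := by
  unfold wn at *
  rw [Option.isSome_iff_exists] at *
  obtain ⟨a, ha⟩ := hs
  exact ⟨a, Code.evaln_mono h ha⟩

theorem mem_Wset_iff {e x : ℕ} : x ∈ Wset e ↔ ∃ s, wn e s x = true := by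
  unfold Wset wn
  simp only [Set.mem_ofPred_eq, Part.dom_iff_mem, Option.isSome_iff_exists]
  constructor
  · rintro ⟨y, hy⟩
    obtain ⟨k, hk⟩ := Code.evaln_complete.1 hy
    exact ⟨k, y, hk⟩
  · rintro ⟨k, y, hk⟩
    exact ⟨y, Code.evaln_sound hk⟩

theorem ce_of_exists {R : ℕ → ℕ → Bool} (hR : Computable₂ R) :
    ∃ c : Code, ∀ x, (c.eval x).Dom ↔ ∃ s, R x s = true := by
  have h : Partrec fun x => Nat.rfind (fun s => Part.some (R x s)) :=
    Partrec.rfind hR.partrec₂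
  obtain ⟨c, hc⟩ := Code.exists_code.1 (Partrec.nat_iff.1 h)
  refine ⟨c, fun x => ?_⟩
  rw [hc]
  refine Nat.rfind_dom.trans ?_
  constructor
  · rintro ⟨n, hn, -⟩
    exact ⟨n, (Part.mem_some_iff.1 hn).symm⟩
  · rintro ⟨n, hn⟩
    exact ⟨n, by simp [hn], fun _ => trivial⟩

theorem ceset_of_exists {R : ℕ → ℕ → Bool} (hR : Computable₂ R) {A : Set ℕ}
    (hA : ∀ x, x ∈ A ↔ ∃ s, R x s = true) : CEset A := by
  obtain ⟨c, hc⟩ := ce_of_exists hR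
  refine ⟨Encodable.encode c, ?_⟩
  ext x
  simp [Wset, hc, hA]

theorem finite_primrec (F : Set ℕ) (hF : F.Finite) :
    ∃ f : ℕ → Bool, Primrec f ∧ ∀ x, f x = true ↔ x ∈ F := by
  induction F, hF using Set.Finite.induction_on with
  | empty => exact ⟨fun _ => false, Primrec.const _, by simp⟩
  | @insert a s _ _ ih =>
    obtain ⟨f, hf, h⟩ := ih
    refine ⟨fun x => (x == a) || f x, ?_, by simp [h]⟩
    exact Primrec.or.comp (Primrec.beq.comp Primrec.id (Primrec.const a)) hf

theorem semilow_of {A C : Set ℕ} (hC : CEset C)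
    (h : ∀ e, (Wset e ∩ Aᶜ).Infinite ↔ (Wset e ∩ C).Infinite) : Semilow15 A := by
  obtain ⟨k, rfl⟩ := hC
  have hR : Computable₂ fun (n s : ℕ) => wn n.unpair.1 s n.unpair.2 && wn k s n.unpair.2 := by
    apply Primrec.to_comp
    have h1 : Primrec fun p : ℕ × ℕ => p.1.unpair.1 :=
      Primrec.fst.comp (Primrec.unpair.comp Primrec.fst)
    have h2 : Primrec fun p : ℕ × ℕ => p.1.unpair.2 :=
      Primrec.snd.comp (Primrec.unpair.comp Primrec.fst)
    exact Primrec.and.comp (wn_comp h1 Primrec.snd h2) (wn_comp (Primrec.const k) Primrec.snd h2)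
  obtain ⟨c, hc⟩ := ce_of_exists hR
  refine ⟨fun e => Encodable.encode (Code.curry c e), ?_, ?_, ?_⟩
  · exact (Primrec.encode.comp (Code.primrec₂_curry.comp (Primrec.const c) Primrec.id)).to_comp
  · intro a b hab
    exact (Code.curry_inj (Encodable.encode_injective hab)).2
  · intro e
    show (Wset e ∩ Aᶜ).Infinite ↔ (Wset (Encodable.encode (Code.curry c e))).Infinite
    rw [h e]
    suffices Wset (Encodable.encode (Code.curry c e)) = Wset e ∩ Wset k by rw [this]
    ext x
    have : x ∈ Wset (Encodable.encode (Code.curry c e)) ↔ (c.eval (Nat.pair e x)).Dom := by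
      simp [Wset, Code.eval_curry]
    rw [this, hc, Set.mem_inter_iff, mem_Wset_iff, mem_Wset_iff]
    simp only [Nat.unpair_pair, Bool.and_eq_true]
    constructor
    · rintro ⟨s, h1, h2⟩
      exact ⟨⟨s, h1⟩, ⟨s, h2⟩⟩
    · rintro ⟨⟨s, h1⟩, ⟨t, h2⟩⟩
      exact ⟨max s t, wn_mono (le_max_left _ _) h1, wn_mono (le_max_right _ _) h2⟩

/-- The complement of `M` is cohesive (w.r.t. c.e. sets). -/
def Maximal (M : Set ℕ) : Prop :=
  CEset M ∧ Mᶜ.Infinite ∧ ∀ e, (Wset e ∩ Mᶜ).Finite ∨ (Mᶜ \ Wset e).Finite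

/-! ### Splittings of a maximal set -/

theorem Maximal.split {M X Y : Set ℕ} (hM : Maximal M) (hX : CEset X) (hY : CEset Y)
    (hd : Disjoint X Y) (hu : X ∪ Y = M) : Semilow15 X ∨ Semilow15 Y := by
  by_cases hYc : CEset Yᶜ
  · exact Or.inr (semilow_of hYc fun e => Iff.rfl)
  · left
    refine semilow_of hY fun e => ⟨fun hinf hfin => ?_, fun hinf => ?_⟩
    · have hfin : (Wset e ∩ Y).Finite := hfin
      apply hYc
      have hcof : (Mᶜ \ Wset e).Finite := by
        rcases hM.2.2 e with h | h
        · exfalso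
          apply hinf
          refine (h.union hfin).subset ?_
          rintro x ⟨hx, hxX⟩
          by_cases hxY : x ∈ Y
          · exact Or.inr ⟨hx, hxY⟩
          · refine Or.inl ⟨hx, ?_⟩
            rw [← hu]
            rintro (h | h)
            · exact hxX h
            · exact hxY h
        · exact h
      obtain ⟨f, hf, hf'⟩ := finite_primrec _ hfin
      obtain ⟨g, hg, hg'⟩ := finite_primrec _ hcof
      obtain ⟨k, rfl⟩ := hX
      refine ceset_of_exists (R := fun x s => wn k s x || ((wn e s x && !(f x)) || g x)) ?_ ?_
      · apply Primrec.to_comp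
        have h0 : Primrec fun p : ℕ × ℕ => p.1 := Primrec.fst
        have h1 : Primrec fun p : ℕ × ℕ => p.2 := Primrec.snd
        exact Primrec.or.comp (wn_comp (Primrec.const k) h1 h0)
          (Primrec.or.comp (Primrec.and.comp (wn_comp (Primrec.const e) h1 h0)
            (Primrec.not.comp (hf.comp h0))) (hg.comp h0))
      · intro x
        have hfx : f x = false ↔ x ∉ Wset e ∩ Y := by rw [← hf' x]; simp
        simp only [Bool.or_eq_true, Bool.and_eq_true, Bool.not_eq_true', hfx, hg', exists_or,
          exists_and_right, exists_const, ← mem_Wset_iff]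
        have hd' : x ∈ Wset k → x ∉ Y := fun h => Set.disjoint_left.1 hd h
        have hu' : x ∈ M ↔ x ∈ Wset k ∨ x ∈ Y := by rw [← hu]; rfl
        simp only [Set.mem_compl_iff, Set.mem_inter_iff, Set.mem_sdiff, hu']
        tauto
    · refine hinf.mono ?_
      rintro x ⟨hx, hxY⟩
      exact ⟨hx, fun h => Set.disjoint_left.1 hd h hxY⟩

/-! ### A maximal set is not semilow_{1.5} -/

/-- Number of `y < n` in `W_{e,s}`. -/
def cnt (e s n : ℕ) : ℕ := Nat.rec 0 (fun y r => r + cond (wn e s y) 1 0) n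

theorem cnt_computable {α : Type*} [Primcodable α] {f g h : α → ℕ} (hf : Computable f)
    (hg : Computable g) (hh : Computable h) : Computable fun a => cnt (f a) (g a) (h a) := by
  unfold cnt
  refine Computable.nat_rec (h := fun a p => p.2 + cond (wn (f a) (g a) p.1) 1 0) hh
    (Computable.const 0) ?_
  have h1 : Computable fun p : α × (ℕ × ℕ) => f p.1 := hf.comp Computable.fst
  have h2 : Computable fun p : α × (ℕ × ℕ) => g p.1 := hg.comp Computable.fst
  have h3 : Computable fun p : α × (ℕ × ℕ) => p.2.1 := Computable.fst.comp Computable.snd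
  have h4 : Computable fun p : α × (ℕ × ℕ) => p.2.2 := Computable.snd.comp Computable.snd
  exact Primrec.nat_add.to_comp.comp h4 (Computable.cond
    (wn_primrec.to_comp.comp ((h1.pair h2).pair h3)) (Computable.const 1) (Computable.const 0))

theorem cnt_eq (e s n : ℕ) :
    cnt e s n = ((Finset.range n).filter (fun y => wn e s y = true)).card := by
  induction n with
  | zero => rfl
  | succ n ih =>
    have : cnt e s (n + 1) = cnt e s n + cond (wn e s n) 1 0 := rfl
    rw [this, ih, Finset.range_add_one, Finset.filter_insert]
    cases h : wn e s n <;> simp [Finset.card_insert_of_notMem]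

theorem cnt_bdd {e : ℕ} (h : (Wset e).Finite) : ∃ b, ∀ x, cnt e x x ≤ b := by
  refine ⟨h.toFinset.card, fun x => ?_⟩
  rw [cnt_eq]
  apply Finset.card_le_card
  intro y hy
  rw [Finset.mem_filter] at hy
  rw [Set.Finite.mem_toFinset, mem_Wset_iff]
  exact ⟨x, hy.2⟩

theorem cnt_unbdd {e : ℕ} (h : (Wset e).Infinite) (b : ℕ) : ∃ n, ∀ x ≥ n, b < cnt e x x := by
  obtain ⟨F, hF, hc⟩ := h.exists_subset_card_eq (b + 1)
  have : ∃ n, ∀ y ∈ F, y < n ∧ wn e n y = true := by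
    have hF' : ∀ y ∈ F, ∃ s, wn e s y = true := fun y hy => mem_Wset_iff.1 (hF hy)
    choose! s hs using hF'
    refine ⟨F.sup s + F.sup id + 1, fun y hy => ⟨?_, ?_⟩⟩
    · have := Finset.le_sup (f := id) hy
      simp only [id] at this
      omega
    · refine wn_mono ?_ (hs y hy)
      have := Finset.le_sup (f := s) hy
      omega
  obtain ⟨n, hn⟩ := this
  refine ⟨n, fun x hx => ?_⟩
  have : F ⊆ (Finset.range x).filter (fun y => wn e x y = true) := by
    intro y hy
    rw [Finset.mem_filter, Finset.mem_range]
    exact ⟨(hn y hy).1.trans_le hx, wn_mono hx (hn y hy).2⟩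
  have := Finset.card_le_card this
  rw [cnt_eq]
  omega

theorem cnt_cmp {u v : ℕ} (hu : (Wset u).Finite) (hv : (Wset v).Infinite) :
    ∃ n, ∀ x ≥ n, cnt u x x < cnt v x x := by
  obtain ⟨b, hb⟩ := cnt_bdd hu
  obtain ⟨n, hn⟩ := cnt_unbdd hv b
  exact ⟨n, fun x hx => (hb x).trans_lt (hn x hx)⟩

theorem test_code (k : ℕ) : ∃ z : Code, ∀ x, (z.eval x).Dom ↔ x = k := by
  obtain ⟨z, hz⟩ := ce_of_exists (R := fun x _ => x == k)
    (Primrec.beq.comp Primrec.fst (Primrec.const k)).to_comp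
  exact ⟨z, fun x => by simp [hz]⟩

theorem Maximal.not_semilow {M : Set ℕ} (hM : Maximal M) : ¬ Semilow15 M := by
  rintro ⟨f, hf, -, hfM⟩
  simp only at hfM
  obtain ⟨z0, hz0⟩ := test_code 0
  obtain ⟨z1, hz1⟩ := test_code 1
  let v : Code → ℕ := fun c => Encodable.encode (Code.comp z0 c)
  let u : Code → ℕ := fun c => Encodable.encode (Code.comp z1 c)
  have hv : Computable v :=
    (Primrec.encode.comp (Code.primrec₂_comp.comp (Primrec.const z0) Primrec.id)).to_comp
  have hu : Computable u :=
    (Primrec.encode.comp (Code.primrec₂_comp.comp (Primrec.const z1) Primrec.id)).to_comp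
  let G : Code → ℕ → ℕ := fun c x =>
    cond (decide (cnt (f (v c)) x x < cnt (f (u c)) x x)) 0 1
  have hG : Computable₂ G := by
    have h1 : Computable fun p : Code × ℕ => f (v p.1) := hf.comp (hv.comp Computable.fst)
    have h2 : Computable fun p : Code × ℕ => f (u p.1) := hf.comp (hu.comp Computable.fst)
    have h3 : Computable fun p : Code × ℕ => p.2 := Computable.snd
    have hlt : Computable fun p : ℕ × ℕ => decide (p.1 < p.2) :=
      (Primrec.nat_lt.decide).to_comp
    exact Computable.cond (hlt.comp ((cnt_computable h1 h3 h3).pair (cnt_computable h2 h3 h3)))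
      (Computable.const 0) (Computable.const 1)
  obtain ⟨c, hc⟩ := Code.fixed_point₂ hG.partrec₂
  have hc' : ∀ x, c.eval x = Part.some (G c x) := fun x => by rw [hc]; rfl
  have hV : ∀ x, x ∈ Wset (v c) ↔ G c x = 0 := by
    intro x
    have : x ∈ Wset (v c) ↔ (z0.eval (G c x)).Dom := by
      simp only [Wset, v, Code.eval, hc', Denumerable.ofNat_encode, Set.mem_ofPred_eq]
      exact Iff.of_eq (congrArg Part.Dom (Part.bind_some _ _))
    rw [this, hz0]
  have hU : ∀ x, x ∈ Wset (u c) ↔ G c x = 1 := by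
    intro x
    have : x ∈ Wset (u c) ↔ (z1.eval (G c x)).Dom := by
      simp only [Wset, u, Code.eval, hc', Denumerable.ofNat_encode, Set.mem_ofPred_eq]
      exact Iff.of_eq (congrArg Part.Dom (Part.bind_some _ _))
    rw [this, hz1]
  have hVU : ∀ x, x ∈ Wset (v c) ↔ x ∉ Wset (u c) := by
    intro x
    rw [hV, hU]
    simp only [G]
    cases decide (cnt (f (v c)) x x < cnt (f (u c)) x x) <;> simp
  have e1 := hfM (v c)
  have e2 := hfM (u c)
  have hMc := hM.2.1
  rcases hM.2.2 (v c) with hfin | hfin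
  · -- `V ∩ Mᶜ` finite
    have h1 : (Wset (f (v c))).Finite := by
      by_contra h
      exact (e1.2 h) hfin
    have h2 : (Wset (f (u c))).Infinite := by
      apply e2.1
      intro h
      apply hMc
      refine (hfin.union h).subset fun x hx => ?_
      by_cases hxu : x ∈ Wset (u c)
      · exact Or.inr ⟨hxu, hx⟩
      · exact Or.inl ⟨(hVU x).2 hxu, hx⟩
    obtain ⟨n, hn⟩ := cnt_cmp h1 h2
    refine e2.2 h2 ((Set.finite_lt_nat n).subset ?_)
    rintro x ⟨hx, -⟩
    by_contra hxn
    have := hn x (not_lt.1 hxn)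
    rw [hU] at hx
    simp [G, this] at hx
  · have h2 : (Wset (f (u c))).Finite := by
      by_contra h
      refine (e2.2 h) (hfin.subset ?_)
      rintro x ⟨hx, hxM⟩
      exact ⟨hxM, fun h' => (hVU x).1 h' hx⟩
    have h1 : (Wset (f (v c))).Infinite := by
      apply e1.1
      intro h
      apply hMc
      refine (hfin.union h).subset fun x hx => ?_
      by_cases hxu : x ∈ Wset (v c)
      · exact Or.inr ⟨hxu, hx⟩
      · exact Or.inl ⟨hx, hxu⟩
    obtain ⟨n, hn⟩ := cnt_cmp h2 h1
    refine e1.2 h1 ((Set.finite_lt_nat n).subset ?_)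
    rintro x ⟨hx, -⟩
    by_contra hxn
    have := hn x (not_lt.1 hxn)
    rw [hV] at hx
    simp [G, decide_eq_false this.not_gt] at hx

/-! ### Construction of a maximal set -/

/-- The `n`-state of `x` at stage `s`. -/
def st (n x s : ℕ) : ℕ := Nat.rec 0 (fun e r => 2 * r + cond (wn e s x) 1 0) n

theorem st_succ (n x s : ℕ) : st (n + 1) x s = 2 * st n x s + cond (wn n s x) 1 0 := rfl

theorem st_comp {α : Type*} [Primcodable α] {f g h : α → ℕ} (hf : Primrec f)
    (hg : Primrec g) (hh : Primrec h) : Primrec fun a => st (f a) (g a) (h a) := by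
  unfold st
  refine Primrec.nat_rec' (h := fun a p => 2 * p.2 + cond (wn p.1 (h a) (g a)) 1 0) hf
    (Primrec.const 0) ?_
  have h1 : Primrec fun p : α × (ℕ × ℕ) => g p.1 := hg.comp Primrec.fst
  have h2 : Primrec fun p : α × (ℕ × ℕ) => h p.1 := hh.comp Primrec.fst
  have h3 : Primrec fun p : α × (ℕ × ℕ) => p.2.1 := Primrec.fst.comp Primrec.snd
  have h4 : Primrec fun p : α × (ℕ × ℕ) => p.2.2 := Primrec.snd.comp Primrec.snd
  exact Primrec.nat_add.comp (Primrec.nat_mul.comp (Primrec.const 2) h4) (Primrec.cond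
    (wn_comp h3 h2 h1) (Primrec.const 1) (Primrec.const 0))

theorem st_mono (n x : ℕ) {s t : ℕ} (h : s ≤ t) : st n x s ≤ st n x t := by
  induction n with
  | zero => exact le_rfl
  | succ n ih =>
    rw [st_succ, st_succ]
    have : cond (wn n s x) 1 0 ≤ cond (wn n t x) 1 0 := by
      cases hw : wn n s x
      · simp
      · rw [wn_mono h hw]
    omega

theorem st_lt (n x s : ℕ) : st n x s < 2 ^ n := by
  induction n with
  | zero => exact Nat.one_pos
  | succ n ih =>
    rw [st_succ, pow_succ]
    cases wn n s x <;> simp <;> omega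

/-- a monotone bounded sequence of naturals is eventually constant -/
theorem mono_bdd (f : ℕ → ℕ) (n b : ℕ) (hm : ∀ s ≥ n, f s ≤ f (s + 1)) (hb : ∀ s, f s ≤ b) :
    ∃ m ≥ n, ∀ s ≥ m, f (s + 1) = f s := by
  by_contra! hcon
  have : ∀ k, ∃ m ≥ n, k ≤ f m := by
    intro k
    induction k with
    | zero => exact ⟨n, le_rfl, Nat.zero_le _⟩
    | succ k ih =>
      obtain ⟨m, hm1, hm2⟩ := ih
      obtain ⟨s, hs, hne⟩ := hcon m hm1
      have hle : f m ≤ f s := by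
        clear hne
        induction s, hs using Nat.le_induction with
        | base => exact le_rfl
        | succ s hs' ih' => exact ih'.trans (hm s (hm1.trans hs'))
      have := hm s (hm1.trans hs)
      exact ⟨s + 1, by omega, by omega⟩
  obtain ⟨m, -, hm⟩ := this (b + 1)
  have := hb m
  omega

/-- One shift of the markers: `(e, d)` moves every marker `i ≥ e` to the place of `i + d`. -/
def shift (i : ℕ) (p : ℕ × ℕ) : ℕ := if p.1 ≤ i then i + p.2 else i

/-- Position of marker `i` after a history of shifts (most recent first). -/
def pos (h : List (ℕ × ℕ)) (i : ℕ) : ℕ := h.foldl shift i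

/-- One stage of the construction. -/
def nxt (s : ℕ) (h : List (ℕ × ℕ)) : List (ℕ × ℕ) :=
  if s.unpair.1.unpair.1 < s.unpair.1.unpair.2 ∧
      st s.unpair.1.unpair.1 (pos h s.unpair.1.unpair.1) s <
        st s.unpair.1.unpair.1 (pos h s.unpair.1.unpair.2) s then
    (s.unpair.1.unpair.1, s.unpair.1.unpair.2 - s.unpair.1.unpair.1) :: h
  else h

/-- History at stage `s`. -/
def hist (s : ℕ) : List (ℕ × ℕ) := Nat.rec [] nxt s

/-- Position of marker `i` at stage `s`. -/
def A (s i : ℕ) : ℕ := pos (hist s) i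

theorem pos_comp {α : Type*} [Primcodable α] {f : α → List (ℕ × ℕ)} {g : α → ℕ}
    (hf : Primrec f) (hg : Primrec g) : Primrec fun a => pos (f a) (g a) := by
  unfold pos
  refine Primrec.list_foldl (h := fun _ q => shift q.1 q.2) hf hg ?_
  unfold shift
  have h1 : Primrec fun p : α × (ℕ × (ℕ × ℕ)) => p.2.1 := Primrec.fst.comp Primrec.snd
  have h2 : Primrec fun p : α × (ℕ × (ℕ × ℕ)) => p.2.2.1 :=
    Primrec.fst.comp (Primrec.snd.comp Primrec.snd)
  have h3 : Primrec fun p : α × (ℕ × (ℕ × ℕ)) => p.2.2.2 :=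
    Primrec.snd.comp (Primrec.snd.comp Primrec.snd)
  exact Primrec.ite (Primrec.nat_le.comp h2 h1) (Primrec.nat_add.comp h1 h3) h1

theorem nxt_primrec : Primrec₂ nxt := by
  unfold nxt
  have h0 : Primrec fun p : ℕ × List (ℕ × ℕ) => p.1 := Primrec.fst
  have h1 : Primrec fun p : ℕ × List (ℕ × ℕ) => p.2 := Primrec.snd
  have hu : Primrec fun p : ℕ × List (ℕ × ℕ) => p.1.unpair.1.unpair :=
    Primrec.unpair.comp (Primrec.fst.comp (Primrec.unpair.comp h0))
  have he := Primrec.fst.comp hu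
  have hj := Primrec.snd.comp hu
  exact Primrec.ite (PrimrecPred.and (Primrec.nat_lt.comp he hj)
    (Primrec.nat_lt.comp (st_comp he (pos_comp h1 he) h0) (st_comp he (pos_comp h1 hj) h0)))
    (Primrec.list_cons.comp (he.pair (Primrec.nat_sub.comp hj he)) h1) h1

theorem hist_primrec : Primrec hist := by
  unfold hist
  exact Primrec.nat_rec' (h := fun _ p => nxt p.1 p.2) Primrec.id (Primrec.const [])
    ((nxt_primrec.comp (Primrec.fst.comp Primrec.snd) (Primrec.snd.comp Primrec.snd)).to₂)

/-- The stage `s` acts for the pair `(e, j)`. -/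
def Act (s e j : ℕ) : Prop :=
  s.unpair.1 = Nat.pair e j ∧ e < j ∧ st e (A s e) s < st e (A s j) s

theorem A_zero (i : ℕ) : A 0 i = i := rfl

theorem A_succ_act {s e j : ℕ} (h : Act s e j) (i : ℕ) :
    A (s + 1) i = if e ≤ i then A s (i + (j - e)) else A s i := by
  obtain ⟨h1, h2, h3⟩ := h
  have : hist (s + 1) = (e, j - e) :: hist s := by
    show nxt s (hist s) = _
    unfold A at h3
    simp [nxt, h1, h2, h3]
  unfold A
  rw [this]
  show pos (hist s) (shift i (e, j - e)) = _
  unfold shift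
  split_ifs <;> rfl

theorem A_succ_nact {s : ℕ} (h : ¬ ∃ e j, Act s e j) (i : ℕ) : A (s + 1) i = A s i := by
  have : hist (s + 1) = hist s := by
    show nxt s (hist s) = _
    unfold nxt
    rw [if_neg]
    rintro ⟨h2, h3⟩
    exact h ⟨_, _, by simp, h2, h3⟩
  unfold A
  rw [this]

theorem A_strictMono (s : ℕ) : StrictMono (A s) := by
  induction s with
  | zero => exact fun a b h => h
  | succ s ih =>
    intro a b hab
    by_cases h : ∃ e j, Act s e j
    · obtain ⟨e, j, h⟩ := h
      rw [A_succ_act h, A_succ_act h]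
      split_ifs
      · exact ih (by omega)
      · omega
      · exact ih (by omega)
      · exact ih hab
    · rw [A_succ_nact h, A_succ_nact h]
      exact ih hab

theorem A_range_succ (s i : ℕ) : ∃ k, A (s + 1) i = A s k := by
  by_cases h : ∃ e j, Act s e j
  · obtain ⟨e, j, h⟩ := h
    rw [A_succ_act h]
    split_ifs
    · exact ⟨_, rfl⟩
    · exact ⟨_, rfl⟩
  · exact ⟨i, A_succ_nact h i⟩

theorem A_range {s t : ℕ} (h : s ≤ t) (i : ℕ) : ∃ k, A t i = A s k := by
  induction t, h using Nat.le_induction generalizing i with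
  | base => exact ⟨i, rfl⟩
  | succ t _ ih =>
    obtain ⟨k, hk⟩ := A_range_succ t i
    obtain ⟨l, hl⟩ := ih k
    exact ⟨l, hk.trans hl⟩

theorem act_ne {s e j : ℕ} (h : Act s e j) : A (s + 1) e = A s j ∧ A (s + 1) e ≠ A s e := by
  have hlt := h.2.1
  have : A (s + 1) e = A s j := by
    rw [A_succ_act h, if_pos le_rfl]
    congr 1
    omega
  refine ⟨this, ?_⟩
  rw [this]
  exact (A_strictMono s hlt).ne'

/-- Every marker reaches a limit. -/
theorem conv (n : ℕ) : ∃ s0, ∀ s ≥ s0, ∀ i < n, A s i = A s0 i := by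
  induction n with
  | zero => exact ⟨0, by simp⟩
  | succ n ih =>
    obtain ⟨s0, h0⟩ := ih
    have hact : ∀ s ≥ s0, ∀ e j, Act s e j → n ≤ e := by
      intro s hs e j h
      by_contra hlt
      push Not at hlt
      apply (act_ne h).2
      rw [h0 s hs e hlt, h0 (s + 1) (by omega) e hlt]
    -- the state of marker `n` strictly increases at each change
    have key : ∀ s ≥ s0, A (s + 1) n = A s n ∨
        st n (A s n) s < st n (A (s + 1) n) (s + 1) := by
      intro s hs
      by_cases h : ∃ e j, Act s e j
      · obtain ⟨e, j, h⟩ := h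
        have hne := hact s hs e j h
        rcases hne.eq_or_lt with rfl | hlt
        · right
          rw [(act_ne h).1]
          exact h.2.2.trans_le (st_mono _ _ (Nat.le_succ s))
        · left
          rw [A_succ_act h, if_neg (by omega)]
      · exact Or.inl (A_succ_nact h n)
    obtain ⟨m, hm, hm'⟩ := mono_bdd (fun s => st n (A s n) s) s0 (2 ^ n)
      (by
        intro s hs
        rcases key s hs with h | h
        · show st n (A s n) s ≤ st n (A (s + 1) n) (s + 1)
          rw [h]
          exact st_mono _ _ (Nat.le_succ s)
        · exact h.le)
      (fun s => (st_lt _ _ _).le)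
    have hconst : ∀ s ≥ m, A s n = A m n := by
      intro s hs
      induction s, hs using Nat.le_induction with
      | base => rfl
      | succ s hs ih =>
        rcases key s (hm.trans hs) with h | h
        · exact h.trans ih
        · exact absurd (hm' s hs) h.ne'
    refine ⟨m, fun s hs i hi => ?_⟩
    rcases Nat.lt_succ_iff_lt_or_eq.1 hi with hi | rfl
    · rw [h0 s (hm.trans hs) i hi, h0 m hm i hi]
    · exact hconst s hs

theorem exists_limit : ∃ a : ℕ → ℕ, ∀ n, ∃ s0, ∀ s ≥ s0, ∀ i < n, A s i = a i := by
  have h : ∀ i, ∃ x, ∃ s0, ∀ s ≥ s0, A s i = x := by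
    intro i
    obtain ⟨s0, h0⟩ := conv (i + 1)
    exact ⟨_, s0, fun s hs => h0 s hs i (Nat.lt_succ_self i)⟩
  choose a t ht using h
  refine ⟨a, fun n => ?_⟩
  obtain ⟨s0, h0⟩ := conv n
  refine ⟨s0, fun s hs i hi => ?_⟩
  rw [h0 s hs i hi, ← h0 (max s0 (t i)) (le_max_left _ _) i hi]
  exact ht i _ (le_max_right _ _)

/-- The states stabilise. -/
theorem st_conv (n x : ℕ) : ∃ s0, ∀ s ≥ s0, st n x s = st n x s0 := by
  obtain ⟨m, -, hm⟩ := mono_bdd (fun s => st n x s) 0 (2 ^ n)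
    (fun s _ => st_mono _ _ (Nat.le_succ s)) (fun s => (st_lt _ _ _).le)
  refine ⟨m, fun s hs => ?_⟩
  induction s, hs using Nat.le_induction with
  | base => rfl
  | succ s hs ih => exact (hm s hs).trans ih

open Classical in
/-- The final `n`-state of `x`. -/
noncomputable def finSt (n x : ℕ) : ℕ :=
  Nat.rec 0 (fun e r => 2 * r + if x ∈ Wset e then 1 else 0) n

open Classical in
theorem finSt_succ (n x : ℕ) :
    finSt (n + 1) x = 2 * finSt n x + if x ∈ Wset n then 1 else 0 := rfl

theorem st_finSt (n x : ℕ) : ∃ s0, ∀ s ≥ s0, st n x s = finSt n x := by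
  induction n with
  | zero => exact ⟨0, fun _ _ => rfl⟩
  | succ n ih =>
    obtain ⟨s0, h0⟩ := ih
    by_cases hx : x ∈ Wset n
    · obtain ⟨t, ht⟩ := mem_Wset_iff.1 hx
      refine ⟨max s0 t, fun s hs => ?_⟩
      rw [st_succ, finSt_succ, h0 s ((le_max_left _ _).trans hs),
        wn_mono ((le_max_right _ _).trans hs) ht, if_pos hx]
      rfl
    · refine ⟨s0, fun s hs => ?_⟩
      have : wn n s x = false := by
        by_contra h
        exact hx (mem_Wset_iff.2 ⟨s, by simpa using h⟩)
      rw [st_succ, finSt_succ, h0 s hs, this, if_neg hx]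
      rfl

theorem finSt_prefix {k n x y : ℕ} (hkn : k ≤ n) (h : finSt n x ≤ finSt n y) :
    finSt k x ≤ finSt k y := by
  induction n, hkn using Nat.le_induction with
  | base => exact h
  | succ n _ ih =>
    apply ih
    rw [finSt_succ, finSt_succ] at h
    split_ifs at h <;> omega

theorem exists_maximal : ∃ M : Set ℕ, Maximal M := by
  obtain ⟨a, ha⟩ := exists_limit
  have amono : StrictMono a := by
    intro i j hij
    obtain ⟨s, hs⟩ := ha (j + 1)
    rw [← hs s le_rfl i (by omega), ← hs s le_rfl j (by omega)]
    exact A_strictMono s hij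
  let M : Set ℕ := {x | ∃ s, ∀ i < x + 1, A s i ≠ x}
  have hMc : Mᶜ = Set.range a := by
    ext x
    have : x ∈ Mᶜ ↔ ∀ s, ∃ i < x + 1, A s i = x := by
      simp only [M, Set.mem_compl_iff, Set.mem_ofPred_eq]
      push Not
      rfl
    rw [this]
    constructor
    · intro h
      obtain ⟨s, hs⟩ := ha (x + 1)
      obtain ⟨i, hi, hx⟩ := h s
      exact ⟨i, by rw [← hx, hs s le_rfl i hi]⟩
    · rintro ⟨i, rfl⟩ s
      obtain ⟨t, ht⟩ := ha (i + 1)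
      obtain ⟨k, hk⟩ := A_range (le_max_left s t) i
      rw [ht _ (le_max_right s t) i (Nat.lt_succ_self i)] at hk
      refine ⟨k, ?_, hk.symm⟩
      have := (A_strictMono s).id_le k
      simp only [id] at this
      omega
  refine ⟨M, ?_, ?_, ?_⟩
  · have hR : PrimrecRel fun (x s : ℕ) => ∀ i < x + 1, A s i ≠ x := by
      have h1 : PrimrecRel fun (i : ℕ) (p : ℕ × ℕ) => A p.2 i ≠ p.1 := by
        refine PrimrecPred.not (Primrec.eq.comp ?_ (Primrec.fst.comp Primrec.snd))
        exact pos_comp (hist_primrec.comp (Primrec.snd.comp Primrec.snd)) Primrec.fst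
      have h2 : Primrec fun p : ℕ × ℕ => List.range (p.1 + 1) :=
        Primrec.list_range.comp (Primrec.succ.comp Primrec.fst)
      have h3 : Primrec fun p : ℕ × ℕ => p := Primrec.id
      have h4 : PrimrecPred fun p : ℕ × ℕ => ∀ i ∈ List.range (p.1 + 1), A p.2 i ≠ p.1 :=
        PrimrecRel.comp h1.forall_mem_list h2 h3
      exact h4.of_eq fun p => by simp only [List.mem_range]
    exact ceset_of_exists (R := fun x s => decide (∀ i < x + 1, A s i ≠ x))
      hR.decide.to_comp (fun x => by simp [M])
  · rw [hMc]
    exact Set.infinite_range_of_injective amono.injective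
  · intro e
    -- final states are non-increasing
    have hdec : ∀ i j, i < j → finSt i (a j) ≤ finSt i (a i) := by
      intro i j hij
      by_contra! hlt
      obtain ⟨s1, h1⟩ := ha (j + 1)
      obtain ⟨s2, h2⟩ := st_finSt i (a i)
      obtain ⟨s3, h3⟩ := st_finSt i (a j)
      let t := s1 + s2 + s3
      have ht : t ≤ Nat.pair (Nat.pair i j) t := Nat.right_le_pair _ _
      set s := Nat.pair (Nat.pair i j) t with hs
      have hact : Act s i j := by
        refine ⟨by simp [hs], hij, ?_⟩
        rw [h1 s (by omega) i (by omega), h1 s (by omega) j (by omega), h2 s (by omega),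
          h3 s (by omega)]
        exact hlt
      apply (act_ne hact).2
      rw [h1 s (by omega) i (by omega), h1 (s + 1) (by omega) i (by omega)]
    have hanti : ∀ i ≥ e + 1, finSt (e + 1) (a (i + 1)) ≤ finSt (e + 1) (a i) :=
      fun i hi => finSt_prefix hi (hdec i (i + 1) (Nat.lt_succ_self i))
    have hbd : ∀ x, finSt (e + 1) x ≤ 2 ^ (e + 1) := by
      intro x
      obtain ⟨s, hs⟩ := st_finSt (e + 1) x
      rw [← hs s le_rfl]
      exact (st_lt _ _ _).le
    obtain ⟨m, -, hm⟩ := mono_bdd (fun i => 2 ^ (e + 1) - finSt (e + 1) (a i)) (e + 1) (2 ^ (e + 1))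
      (fun i hi => Nat.sub_le_sub_left (hanti i hi) _) (fun i => Nat.sub_le _ _)
    have hconst : ∀ i ≥ m, finSt (e + 1) (a i) = finSt (e + 1) (a m) := by
      intro i hi
      induction i, hi using Nat.le_induction with
      | base => rfl
      | succ i hi ih =>
        have h1 := hm i hi
        have h2 := hbd (a i)
        have h3 := hbd (a (i + 1))
        omega
    have hmem : ∀ i ≥ m, (a i ∈ Wset e ↔ a m ∈ Wset e) := by
      intro i hi
      have := hconst i hi
      rw [finSt_succ, finSt_succ] at this
      split_ifs at this with h1 h2 h2
      · exact iff_of_true h1 h2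
      · omega
      · omega
      · exact iff_of_false h1 h2
    have hfin : (Set.image a {i | i < m}).Finite := (Set.finite_lt_nat m).image a
    rw [hMc]
    by_cases hW : a m ∈ Wset e
    · right
      refine hfin.subset ?_
      rintro x ⟨⟨i, rfl⟩, hx⟩
      refine ⟨i, ?_, rfl⟩
      by_contra hi
      exact hx ((hmem i (not_lt.1 hi)).2 hW)
    · left
      refine hfin.subset ?_
      rintro x ⟨hx, ⟨i, rfl⟩⟩
      refine ⟨i, ?_, rfl⟩
      by_contra hi
      exact hW ((hmem i (not_lt.1 hi)).1 hx)

end MaxSet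

/-- There is a non-semilow_{1.5} c.e. set `B` such that for every splitting of `B` into
disjoint c.e. sets `X`, `Y` with `X ∪ Y = B`, at least one of `X`, `Y` is semilow_{1.5}. -/
theorem non_semilow15_set_with_semilow15_half_of_every_splitting :
    ∃ B : Set ℕ, CEset B ∧ ¬ Semilow15 B ∧
      ∀ X Y : Set ℕ, CEset X → CEset Y → Disjoint X Y → X ∪ Y = B →
        Semilow15 X ∨ Semilow15 Y := by
  obtain ⟨M, hM⟩ := MaxSet.exists_maximal
  exact ⟨M, hM.1, hM.not_semilow, fun X Y hX hY hd hu => hM.split hX hY hd hu⟩
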